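/- Let X be a galois object with root s_0 : X → K̄, and let End(X) be the monoid (under composition) of K-algebra endomorphisms of X commuting with every ψ_𝔭. For f, f' ∈ End(X), the following are equivalent: (a) f and f' are 𝒥-equivalent in End(X), i.e., there exist g, g' ∈ End(X) with f = f' ∘ g and f' = f ∘ g'; (b) s_0 ∘ f and s_0 ∘ f' lie in the same Gal(K̄/K)-orbit, i.e., there exists σ ∈ Gal(K̄/K) with s_0 ∘ f = σ ∘ (s_0 ∘ f'). -/

import Mathlib

open NumberField

set_option synthInstance.maxHeartbeats 1000000
set_option maxHeartbeats 1000000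

/-- The commutative monoid of nonzero ideals of a domain (under ideal multiplication). -/
def NZI (R : Type*) [CommRing R] [IsDomain R] : Submonoid (Ideal R) where
  carrier := {I | I ≠ ⊥}
  mul_mem' := by
    intro a b ha hb h
    rcases Ideal.mul_eq_bot.mp h with h' | h'
    · exact ha h'
    · exact hb h'
  one_mem' := by
    simpa [Ideal.one_eq_top] using (top_ne_bot : (⊤ : Ideal R) ≠ ⊥)

/-- A fixed algebraic closure of `K`. -/
abbrev Kbar (K : Type*) [Field K] := AlgebraicClosure K

variable (K : Type*) [Field K] [NumberField K]
variable (X : Type*) [CommRing X] [Algebra K X]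

/-- `A` is an integral model of the `Λ`-ring `(X, ψ)` over `K`: an `O_K`-subalgebra of `X`
finitely generated as an `O_K`-module, spanning `X` over `K`, stable under the `ψ_𝔭`, and
with `ψ_𝔭(a) - a^{N𝔭} ∈ 𝔭A` for all `a ∈ A` and all nonzero primes `𝔭`. -/
def IsIntegralModel (ψ : NZI (𝓞 K) →* (X →ₐ[K] X)) (A : Subalgebra (𝓞 K) X) : Prop :=
  (Subalgebra.toSubmodule A).FG ∧
  Submodule.span K (A : Set X) = ⊤ ∧
  (∀ (p : Ideal (𝓞 K)) (_ : p.IsPrime) (hp : p ≠ ⊥), ∀ a ∈ A, ψ ⟨p, hp⟩ a ∈ A) ∧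
  (∀ (p : Ideal (𝓞 K)) (_ : p.IsPrime) (hp : p ≠ ⊥), ∀ a ∈ A,
    ψ ⟨p, hp⟩ a - a ^ Ideal.absNorm p ∈
      Submodule.span (𝓞 K) {y | ∃ r ∈ p, ∃ b ∈ A, y = r • b})


section analytic
open Filter Topology

theorem zt_sum (K : Type*) [Field K] [NumberField K] :
    ∀ᶠ s : ℝ in 𝓝[>] 1, Summable (fun I : Ideal (𝓞 K) ↦ (Ideal.absNorm I : ℝ) ^ (-s)) ∧
      ((∑' I : Ideal (𝓞 K), (Ideal.absNorm I : ℝ) ^ (-s) : ℝ) : ℂ) = dedekindZeta K s := by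
  have h := tendsto_sub_one_mul_dedekindZeta_nhdsGT K
  have hne : ((dedekindZeta_residue K : ℝ) : ℂ) ≠ 0 := by
    exact_mod_cast dedekindZeta_residue_ne_zero K
  filter_upwards [h.eventually_ne hne, self_mem_nhdsWithin] with s hs hs1
  have hs1 : 1 < s := hs1
  have hz : dedekindZeta K s ≠ 0 := right_ne_zero_of_mul hs
  set c : ℕ → ℕ := fun n ↦ Nat.card {I : Ideal (𝓞 K) // Ideal.absNorm I = n} with hc
  have hterm : ∀ n, LSeries.term (fun n ↦ (c n : ℂ)) s n = ((c n * (n:ℝ) ^ (-s) : ℝ) : ℂ) := by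
    intro n
    rcases eq_or_ne n 0 with rfl | hn
    · simp [LSeries.term_zero, Real.zero_rpow (by linarith : -s ≠ 0)]
    · rw [LSeries.term_of_ne_zero hn]
      push_cast
      rw [Complex.ofReal_cpow (by positivity), div_eq_mul_inv, Complex.ofReal_neg,
        Complex.cpow_neg]
      simp
  have hsum : LSeriesSummable (fun n ↦ (c n : ℂ)) s := by
    by_contra hcon
    exact hz (tsum_eq_zero_of_not_summable hcon)
  have hsumR : Summable (fun n : ℕ ↦ (c n * (n:ℝ) ^ (-s) : ℝ)) := by
    have := hsum
    unfold LSeriesSummable at this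
    rw [funext hterm] at this
    exact Complex.summable_ofReal.mp this
  have hfin : ∀ n, Finite {I : Ideal (𝓞 K) // Ideal.absNorm I = n} := fun n ↦
    (Ideal.finite_setOfPred_absNorm_eq n)
  have hfib : ∀ n : ℕ, HasSum (fun I : {I : Ideal (𝓞 K) // Ideal.absNorm I = n} ↦
      (Ideal.absNorm I.1 : ℝ) ^ (-s)) (c n * (n:ℝ) ^ (-s)) := by
    intro n
    have := hfin n
    have := Fintype.ofFinite {I : Ideal (𝓞 K) // Ideal.absNorm I = n}
    have hh := hasSum_fintype (fun I : {I : Ideal (𝓞 K) // Ideal.absNorm I = n} ↦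
      (Ideal.absNorm I.1 : ℝ) ^ (-s))
    convert hh using 1
    rw [Finset.sum_congr rfl (fun I _ ↦ by rw [I.2])]
    simp [hc, Nat.card_eq_fintype_card]
  have hS : Summable (fun x : (Σ n : ℕ, {I : Ideal (𝓞 K) // Ideal.absNorm I = n}) ↦
      (Ideal.absNorm x.2.1 : ℝ) ^ (-s)) := by
    rw [summable_sigma_of_nonneg (fun _ ↦ by positivity)]
    refine ⟨fun n ↦ (hfib n).summable, ?_⟩
    simpa only [(hfib _).tsum_eq] using hsumR
  have hH := hS.hasSum.sigma hfib
  have hH2 : (∑' I : Ideal (𝓞 K), (Ideal.absNorm I : ℝ) ^ (-s)) =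
      ∑' n : ℕ, (c n * (n:ℝ) ^ (-s) : ℝ) := by
    rw [hH.tsum_eq, ← (Equiv.sigmaFiberEquiv (fun I : Ideal (𝓞 K) ↦ Ideal.absNorm I)).tsum_eq]
    rfl
  refine ⟨?_, ?_⟩
  · rw [← (Equiv.sigmaFiberEquiv (fun I : Ideal (𝓞 K) ↦ Ideal.absNorm I)).summable_iff]
    exact hS
  · rw [hH2, Complex.ofReal_tsum]
    unfold dedekindZeta LSeries
    exact tsum_congr fun n ↦ (hterm n).symm

theorem zt_tendsto (K : Type*) [Field K] [NumberField K] :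
    Tendsto (fun s : ℝ ↦ (s - 1) * ∑' I : Ideal (𝓞 K), (Ideal.absNorm I : ℝ) ^ (-s)) (𝓝[>] 1)
      (𝓝 (dedekindZeta_residue K)) := by
  have h := tendsto_sub_one_mul_dedekindZeta_nhdsGT K
  have h2 := (Complex.continuous_re.tendsto _).comp h
  rw [Complex.ofReal_re] at h2
  refine h2.congr' ?_
  filter_upwards [zt_sum K] with s hs
  rw [Function.comp_apply, ← hs.2, ← Complex.ofReal_one, ← Complex.ofReal_sub,
    ← Complex.ofReal_mul, Complex.ofReal_re]

/-- nonzero ideals not divisible by any member of `T` -/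
def GdI (K : Type*) [Field K] (T : Finset (Ideal (𝓞 K))) : Set (Ideal (𝓞 K)) :=
  {I | I ≠ ⊥ ∧ ∀ p ∈ T, ¬ p ∣ I}

theorem gd_bound (K : Type*) [Field K] [NumberField K] {s : ℝ} (hs : 1 < s)
    (hS : Summable (fun I : Ideal (𝓞 K) ↦ (Ideal.absNorm I : ℝ) ^ (-s)))
    (T : Finset (Ideal (𝓞 K))) (hT : ∀ p ∈ T, p.IsPrime ∧ p ≠ ⊥) :
    ∑' I : Ideal (𝓞 K), (Ideal.absNorm I : ℝ) ^ (-s) ≤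
      2 ^ T.card * ∑' I : GdI K T, (Ideal.absNorm I.1 : ℝ) ^ (-s) := by
  classical
  induction T using Finset.induction_on with
  | empty =>
    rw [tsum_subtype (GdI K ∅) (fun I ↦ (Ideal.absNorm I : ℝ) ^ (-s))]
    simp only [Finset.card_empty, pow_zero, one_mul]
    refine le_of_eq (tsum_congr fun I ↦ ?_)
    by_cases hI : I = ⊥
    · subst hI
      simp [GdI, Real.zero_rpow (by linarith : -s ≠ 0)]
    · rw [Set.indicator_of_mem]
      simp [GdI, hI]
  | insert p T hp ih =>
    have ih := ih (fun q hq ↦ hT q (Finset.mem_insert_of_mem hq))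
    obtain ⟨hpp, hp0⟩ := hT p (Finset.mem_insert_self _ _)
    set w : Ideal (𝓞 K) → ℝ := fun I ↦ (Ideal.absNorm I : ℝ) ^ (-s) with hw
    have hw0 : ∀ I, 0 ≤ w I := fun I ↦ by simp only [hw]; positivity
    have e1 : ∑' I : GdI K T, w I.1 ≤ ∑' I : GdI K (insert p T), w I.1 +
        (1/2) * ∑' I : GdI K T, w I.1 := by
      have hwp : ∀ J, w (p * J) ≤ (1/2) * w J := by
        intro J
        simp only [hw, map_mul, Nat.cast_mul]
        rw [Real.mul_rpow (by positivity) (by positivity)]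
        refine mul_le_mul_of_nonneg_right ?_ (by positivity)
        have h2 : 2 ≤ Ideal.absNorm p := by
          have h0 : Ideal.absNorm p ≠ 0 := by simpa [Ideal.absNorm_eq_zero_iff] using hp0
          have h1 : Ideal.absNorm p ≠ 1 := by
            rw [Ne, Ideal.absNorm_eq_one_iff]; exact hpp.ne_top
          omega
        have h2' : (2:ℝ) ≤ Ideal.absNorm p := by exact_mod_cast h2
        calc (Ideal.absNorm p : ℝ) ^ (-s) ≤ (Ideal.absNorm p : ℝ) ^ (-1 : ℝ) :=
              Real.rpow_le_rpow_of_exponent_le (by linarith) (by linarith)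
          _ = (Ideal.absNorm p : ℝ)⁻¹ := by rw [Real.rpow_neg_one]
          _ ≤ 1/2 := by rw [one_div]; exact inv_anti₀ (by norm_num) h2'
      -- multiplication by p
      let m : Ideal (𝓞 K) → Ideal (𝓞 K) := fun J ↦ p * J
      have hm : Function.Injective m := fun a b h ↦ mul_left_cancel₀ (by simpa using hp0) h
      have hsub : GdI K T ⊆ GdI K (insert p T) ∪ m '' (GdI K T) := by
        rintro I ⟨hI0, hI⟩
        by_cases hd : p ∣ I
        · right
          obtain ⟨J, rfl⟩ := hd
          refine ⟨J, ⟨?_, fun q hq hqJ ↦ hI q hq (hqJ.mul_left p)⟩, rfl⟩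
          rintro rfl
          exact hI0 (by simp)
        · left
          refine ⟨hI0, fun q hq ↦ ?_⟩
          rcases Finset.mem_insert.mp hq with rfl | hq
          · exact hd
          · exact hI q hq
      calc ∑' I : GdI K T, w I.1
          ≤ ∑' I : GdI K (insert p T), w I.1 + ∑' I : m '' (GdI K T), w I.1 := by
            rw [tsum_subtype _ w, tsum_subtype _ w, tsum_subtype _ w,
              ← (hS.indicator _).tsum_add (hS.indicator _)]
            refine Summable.tsum_le_tsum (fun I ↦ ?_) (hS.indicator _)
              ((hS.indicator _).add (hS.indicator _))
            have p1 := Set.indicator_nonneg (s := GdI K (insert p T)) (fun I _ ↦ hw0 I) I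
            have p2 := Set.indicator_nonneg (s := m '' (GdI K T)) (fun I _ ↦ hw0 I) I
            by_cases hI : I ∈ GdI K T
            · rw [Set.indicator_of_mem hI]
              rcases hsub hI with h | h
              · rw [Set.indicator_of_mem h]; linarith
              · rw [Set.indicator_of_mem h w]; linarith
            · rw [Set.indicator_of_notMem hI]; linarith
        _ ≤ _ := by
            gcongr
            rw [tsum_image w hm.injOn, ← tsum_mul_left]
            refine Summable.tsum_le_tsum (fun J ↦ hwp J.1) ?_ ?_
            · exact (hS.comp_injective hm).comp_injective Subtype.val_injective
            · exact (hS.comp_injective Subtype.val_injective).mul_left _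
    rw [Finset.card_insert_of_notMem hp, pow_succ]
    have : (0:ℝ) < 2 ^ T.card := by positivity
    nlinarith

theorem ms_recover {α β : Type*} (g : α → Prop) (Q1 Q2 : α → β) (u : β → α)
    (h1 : ∀ a, g a → u (Q1 a) = a) (h2 : ∀ a, g a → u (Q2 a) = a)
    (hne : ∀ a, g a → Q1 a ≠ Q2 a) (A B A' B' : Multiset α)
    (hA : ∀ a ∈ A, g a) (hB : ∀ a ∈ B, g a) (hA' : ∀ a ∈ A', g a) (hB' : ∀ a ∈ B', g a)
    (h : A.map Q1 + B.map Q2 = A'.map Q1 + B'.map Q2) : A = A' ∧ B = B' := by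
  classical
  have key : ∀ A B : Multiset α, (∀ a ∈ A, g a) → (∀ a ∈ B, g a) →
      ((A.map Q1 + B.map Q2).filter (fun x ↦ x = Q1 (u x))).map u = A ∧
      ((A.map Q1 + B.map Q2).filter (fun x ↦ ¬ x = Q1 (u x))).map u = B := by
    intro A B hA hB
    have e1 : (A.map Q1).filter (fun x ↦ x = Q1 (u x)) = A.map Q1 := by
      rw [Multiset.filter_eq_self]
      intro x hx
      obtain ⟨a, ha, rfl⟩ := Multiset.mem_map.mp hx
      rw [h1 a (hA a ha)]
    have e2 : (A.map Q1).filter (fun x ↦ ¬ x = Q1 (u x)) = 0 := by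
      rw [Multiset.filter_eq_nil]
      intro x hx
      obtain ⟨a, ha, rfl⟩ := Multiset.mem_map.mp hx
      rw [h1 a (hA a ha)]; simp
    have e3 : (B.map Q2).filter (fun x ↦ x = Q1 (u x)) = 0 := by
      rw [Multiset.filter_eq_nil]
      intro x hx
      obtain ⟨a, ha, rfl⟩ := Multiset.mem_map.mp hx
      rw [h2 a (hB a ha)]
      exact (hne a (hB a ha)).symm
    have e4 : (B.map Q2).filter (fun x ↦ ¬ x = Q1 (u x)) = B.map Q2 := by
      rw [Multiset.filter_eq_self]
      intro x hx
      obtain ⟨a, ha, rfl⟩ := Multiset.mem_map.mp hx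
      rw [h2 a (hB a ha)]
      exact (hne a (hB a ha)).symm
    rw [Multiset.filter_add, Multiset.filter_add, e1, e2, e3, e4, add_zero, zero_add,
      Multiset.map_map, Multiset.map_map]
    constructor
    · conv_rhs => rw [← Multiset.map_id A]
      exact Multiset.map_congr rfl fun a ha ↦ h1 a (hA a ha)
    · conv_rhs => rw [← Multiset.map_id B]
      exact Multiset.map_congr rfl fun a ha ↦ h2 a (hB a ha)
  have k1 := key A B hA hB
  have k2 := key A' B' hA' hB'
  rw [h] at k1
  exact ⟨k1.1.symm.trans k2.1, k1.2.symm.trans k2.2⟩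

open UniqueFactorizationMonoid in
theorem no_split (K E : Type*) [Field K] [NumberField K] [Field E] [NumberField E] [Algebra K E]
    (T : Finset (Ideal (𝓞 K))) (hT : ∀ p ∈ T, p.IsPrime ∧ p ≠ ⊥)
    (h : ∀ p : Ideal (𝓞 K), p.IsPrime → p ≠ ⊥ → p ∉ T → ∃ Q1 Q2 : Ideal (𝓞 E),
      (Q1.IsPrime ∧ Q1 ≠ ⊥ ∧ Q1.under (𝓞 K) = p ∧ Ideal.absNorm Q1 = Ideal.absNorm p) ∧
      (Q2.IsPrime ∧ Q2 ≠ ⊥ ∧ Q2.under (𝓞 K) = p ∧ Ideal.absNorm Q2 = Ideal.absNorm p) ∧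
      Q1 ≠ Q2) : False := by
  classical
  set g : Ideal (𝓞 K) → Prop := fun p ↦ p.IsPrime ∧ p ≠ ⊥ ∧ p ∉ T with hg
  have h' : ∀ p : Ideal (𝓞 K), ∃ Q1 Q2 : Ideal (𝓞 E), g p → 
      (Q1.IsPrime ∧ Q1 ≠ ⊥ ∧ Q1.under (𝓞 K) = p ∧ Ideal.absNorm Q1 = Ideal.absNorm p) ∧
      (Q2.IsPrime ∧ Q2 ≠ ⊥ ∧ Q2.under (𝓞 K) = p ∧ Ideal.absNorm Q2 = Ideal.absNorm p) ∧
      Q1 ≠ Q2 := by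
    intro p
    by_cases hp : g p
    · obtain ⟨Q1, Q2, hQ⟩ := h p hp.1 hp.2.1 hp.2.2
      exact ⟨Q1, Q2, fun _ ↦ hQ⟩
    · exact ⟨⊥, ⊥, fun h ↦ absurd h hp⟩
  choose Q1 Q2 hQ using h'
  let nf : Ideal (𝓞 K) → Multiset (Ideal (𝓞 K)) := normalizedFactors
  have hnf : ∀ I ∈ GdI K T, ∀ p ∈ nf I, g p := by
    intro I hI p hp
    have hpp := prime_of_normalized_factor p hp
    refine ⟨Ideal.isPrime_of_prime hpp, hpp.ne_zero, fun hpT ↦ hI.2 p hpT ?_⟩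
    exact dvd_of_mem_normalizedFactors hp
  have hprod : ∀ I ∈ GdI K T, (nf I).prod = I := fun I hI ↦
    Ideal.prod_normalizedFactors_eq_self (by simpa using hI.1)
  let F : GdI K T × GdI K T → Ideal (𝓞 E) := fun x ↦
    ((nf x.1.1).map Q1 + (nf x.2.1).map Q2).prod
  have hFprime : ∀ x : GdI K T × GdI K T, ∀ q ∈ ((nf x.1.1).map Q1 + (nf x.2.1).map Q2),
      Prime q := by
    intro x q hq
    rw [Multiset.mem_add, Multiset.mem_map, Multiset.mem_map] at hq
    rcases hq with ⟨p, hp, rfl⟩ | ⟨p, hp, rfl⟩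
    · have := hQ p (hnf _ x.1.2 p hp)
      exact Ideal.prime_of_isPrime this.1.2.1 this.1.1
    · have := hQ p (hnf _ x.2.2 p hp)
      exact Ideal.prime_of_isPrime this.2.1.2.1 this.2.1.1
  have hFinj : Function.Injective F := by
    intro x y hxy
    have e : (nf x.1.1).map Q1 + (nf x.2.1).map Q2 = (nf y.1.1).map Q1 + (nf y.2.1).map Q2 := by
      rw [← normalizedFactors_prod_of_prime (hFprime x), ← normalizedFactors_prod_of_prime (hFprime y)]
      exact congrArg _ hxy
    have := ms_recover g Q1 Q2 (fun q ↦ q.under (𝓞 K)) (fun p hp ↦ (hQ p hp).1.2.2.1)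
      (fun p hp ↦ (hQ p hp).2.1.2.2.1) (fun p hp ↦ (hQ p hp).2.2) _ _ _ _
      (hnf _ x.1.2) (hnf _ x.2.2) (hnf _ y.1.2) (hnf _ y.2.2) e
    refine Prod.ext (Subtype.ext ?_) (Subtype.ext ?_)
    · rw [← hprod _ x.1.2, this.1, hprod _ y.1.2]
    · rw [← hprod _ x.2.2, this.2, hprod _ y.2.2]
  have hFnorm : ∀ x, Ideal.absNorm (F x) = Ideal.absNorm x.1.1 * Ideal.absNorm x.2.1 := by
    intro x
    simp only [F]
    rw [Multiset.prod_add, map_mul, map_multiset_prod, map_multiset_prod, Multiset.map_map,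
      Multiset.map_map]
    conv_rhs => rw [← hprod _ x.1.2, ← hprod _ x.2.2, map_multiset_prod, map_multiset_prod]
    congr 2
    · exact Multiset.map_congr rfl fun p hp ↦ (hQ p (hnf _ x.1.2 p hp)).1.2.2.2
    · exact Multiset.map_congr rfl fun p hp ↦ (hQ p (hnf _ x.2.2 p hp)).2.1.2.2.2
  -- analytic part
  have hev : ∀ᶠ s : ℝ in 𝓝[>] 1,
      ((s - 1) * ∑' I : Ideal (𝓞 K), (Ideal.absNorm I : ℝ) ^ (-s)) ^ 2 ≤
      (2 ^ T.card) ^ 2 * ((s - 1) *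
        ((s - 1) * ∑' I : Ideal (𝓞 E), (Ideal.absNorm I : ℝ) ^ (-s))) := by
    filter_upwards [zt_sum K, zt_sum E, self_mem_nhdsWithin] with s hK hE hs
    have hs : 1 < s := hs
    have b1 := gd_bound K hs hK.1 T hT
    set G := ∑' I : GdI K T, (Ideal.absNorm I.1 : ℝ) ^ (-s) with hGd
    have hG : Summable (fun I : GdI K T ↦ (Ideal.absNorm I.1 : ℝ) ^ (-s)) :=
      hK.1.comp_injective Subtype.val_injective
    have b2 : G ^ 2 ≤ ∑' I : Ideal (𝓞 E), (Ideal.absNorm I : ℝ) ^ (-s) := by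
      have hGG : Summable (fun x : GdI K T × GdI K T ↦
          (Ideal.absNorm x.1.1 : ℝ) ^ (-s) * (Ideal.absNorm x.2.1 : ℝ) ^ (-s)) :=
        hG.mul_of_nonneg hG (fun _ ↦ by positivity) (fun _ ↦ by positivity)
      rw [sq, hGd, hG.tsum_mul_tsum hG hGG]
      refine hGG.tsum_le_tsum_of_inj F hFinj (fun _ _ ↦ by positivity) (fun x ↦ ?_) hE.1
      rw [hFnorm, Nat.cast_mul, Real.mul_rpow (by positivity) (by positivity)]
    have hZ0 : 0 ≤ ∑' I : Ideal (𝓞 K), (Ideal.absNorm I : ℝ) ^ (-s) :=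
      tsum_nonneg fun _ ↦ by positivity
    have b3 : (∑' I : Ideal (𝓞 K), (Ideal.absNorm I : ℝ) ^ (-s)) ^ 2 ≤ (2 ^ T.card * G) ^ 2 :=
      pow_le_pow_left₀ hZ0 b1 2
    calc _ = (s-1)^2 * (∑' I : Ideal (𝓞 K), (Ideal.absNorm I : ℝ) ^ (-s)) ^ 2 := by ring
      _ ≤ (s-1)^2 * (2 ^ T.card * G) ^ 2 := by gcongr
      _ = (2 ^ T.card) ^ 2 * ((s-1) * ((s-1) * G^2)) := by ring
      _ ≤ _ := by
        have : 0 ≤ s - 1 := by linarith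
        gcongr
  have t1 := (zt_tendsto K).pow 2
  have t0 : Tendsto (fun s : ℝ ↦ s - 1) (𝓝[>] 1) (𝓝 0) := by
    have : Tendsto (fun s : ℝ ↦ s - 1) (𝓝 1) (𝓝 (1 - 1)) := by
      exact (continuous_id.sub continuous_const).tendsto 1
    rw [sub_self] at this
    exact this.mono_left nhdsWithin_le_nhds
  have t2 := (t0.mul (zt_tendsto E)).const_mul ((2 ^ T.card : ℝ) ^ 2)
  have := le_of_tendsto_of_tendsto t1 t2 hev
  have hpos := dedekindZeta_residue_pos K
  have : 0 < dedekindZeta_residue K ^ 2 := by positivity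
  linarith

end analytic

set_option linter.unusedSectionVars false
section alg

open IsLocalization (coeSubmodule mem_coeSubmodule)

theorem absNorm_eq_natCard (L : Type*) [Field L] [NumberField L] (P : Ideal (𝓞 L)) :
    Ideal.absNorm P = Nat.card (𝓞 L ⧸ P) := rfl

theorem exists_frob (K L : Type*) [Field K] [NumberField K] [Field L] [NumberField L]
    [Algebra K L] [IsGalois K L] (P : Ideal (𝓞 L)) (hP : P.IsPrime) (hP0 : P ≠ ⊥) :
    ∃ φ : L ≃ₐ[K] L, ∀ x : 𝓞 L,
      φ • x - x ^ Ideal.absNorm (P.under (𝓞 K)) ∈ P := by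
  have : Finite (𝓞 L ⧸ P) := Ideal.finiteQuotientOfFreeOfNeBot P hP0
  obtain ⟨φ, hφ⟩ := IsArithFrobAt.exists_of_isInvariant (𝓞 K) Gal(L/K) P
  exact ⟨φ, fun x ↦ hφ x⟩

variable {K L X : Type*} [Field K] [NumberField K] [Field L] [NumberField L]
    [Algebra K L] [CommRing X] [Algebra K X]
variable {ψ : NZI (𝓞 K) →* (X →ₐ[K] X)} {A : Subalgebra (𝓞 K) X}

theorem int_val (hA : IsIntegralModel K X ψ A) (s : X →ₐ[K] L) {a : X} (ha : a ∈ A) :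
    ∃ y : 𝓞 L, (y : L) = s a := by
  have h1 : IsIntegral (𝓞 K) a := IsIntegral.of_mem_of_fg A hA.1 a ha
  have h2 : IsIntegral (𝓞 K) (s a) := h1.map (s.restrictScalars (𝓞 K))
  exact ⟨⟨s a, isIntegral_trans (R := ℤ) (A := 𝓞 K) _ h2⟩, rfl⟩

theorem smul_in (P J : Ideal (𝓞 L)) {r : 𝓞 K} (hr : r ∈ P.under (𝓞 K)) {x : L}
    (hx : x ∈ coeSubmodule L J) : r • x ∈ coeSubmodule L (P * J) := by
  obtain ⟨y, hy, rfl⟩ := (mem_coeSubmodule L J).mp hx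
  refine (mem_coeSubmodule L _).mpr ⟨algebraMap (𝓞 K) (𝓞 L) r * y, Ideal.mul_mem_mul hr hy, ?_⟩
  rw [map_mul, Algebra.smul_def, ← IsScalarTower.algebraMap_apply]

theorem coe_mono {I J : Ideal (𝓞 L)} (h : I ≤ J) {x : L} (hx : x ∈ coeSubmodule L I) :
    x ∈ coeSubmodule L J := by
  obtain ⟨y, hy, rfl⟩ := (mem_coeSubmodule L I).mp hx
  exact (mem_coeSubmodule L _).mpr ⟨y, h hy, rfl⟩

theorem sub_mem_of_coe {J : Ideal (𝓞 L)} {x y : 𝓞 L}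
    (h : (x : L) - (y : L) ∈ coeSubmodule L J) : x - y ∈ J := by
  obtain ⟨z, hz, hz'⟩ := (mem_coeSubmodule L J).mp h
  have : z = x - y := by
    apply FaithfulSMul.algebraMap_injective (𝓞 L) L
    rw [hz', map_sub]
  rwa [← this]

theorem frob_congr (hA : IsIntegralModel K X ψ A) (P : Ideal (𝓞 L)) (p : Ideal (𝓞 K))
    (hpP : P.under (𝓞 K) = p) (hp : p.IsPrime) (hp0 : p ≠ ⊥)
    (φ : L ≃ₐ[K] L) (hφ : ∀ x : 𝓞 L, φ • x - x ^ Ideal.absNorm p ∈ P)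
    (s : X →ₐ[K] L) {a : X} (ha : a ∈ A) :
    (φ.toAlgHom.comp s) a - (s.comp (ψ ⟨p, hp0⟩)) a ∈ coeSubmodule L P := by
  obtain ⟨y, hy⟩ := int_val hA s ha
  have h1 : φ (s a) - (s a) ^ Ideal.absNorm p ∈ coeSubmodule L P := by
    refine (mem_coeSubmodule L _).mpr ⟨_, hφ y, ?_⟩
    rw [map_sub, map_pow, ← hy]
    rfl
  have h2 : ∀ z ∈ Submodule.span (𝓞 K) {y | ∃ r ∈ p, ∃ b ∈ A, y = r • b},
      s z ∈ coeSubmodule L P := by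
    intro z hz
    induction hz using Submodule.span_induction with
    | mem x h =>
      obtain ⟨r, hr, b, hb, rfl⟩ := h
      obtain ⟨v, hv⟩ := int_val hA s hb
      have : s (r • b) = r • s b := map_smul (s.restrictScalars (𝓞 K)) r b
      rw [this]
      have hr' : r ∈ P.under (𝓞 K) := by rw [hpP]; exact hr
      have hsb : s b ∈ coeSubmodule L (⊤ : Ideal (𝓞 L)) :=
        (mem_coeSubmodule L _).mpr ⟨v, Submodule.mem_top, hv⟩
      have := smul_in P ⊤ hr' hsb
      rwa [Ideal.mul_top] at this
    | zero => simp
    | add x y _ _ h1 h2 => rw [map_add]; exact add_mem h1 h2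
    | smul r x _ h =>
      have : s (r • x) = r • s x := map_smul (s.restrictScalars (𝓞 K)) r x
      rw [this, ← algebraMap_smul (𝓞 L) r]
      exact Submodule.smul_mem _ _ h
  have h3 := h2 _ (hA.2.2.2 p hp hp0 a ha)
  rw [map_sub, map_pow] at h3
  have := sub_mem h1 h3
  simpa using this

theorem eq_of_eqOn (hA : IsIntegralModel K X ψ A) {M : Type*} [Field M] [Algebra K M]
    {s t : X →ₐ[K] M} (h : ∀ a ∈ A, s a = t a) : s = t := by
  have : s.toLinearMap = t.toLinearMap := LinearMap.ext_on hA.2.1 h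
  exact AlgHom.toLinearMap_injective this

theorem psi_mem (hA : IsIntegralModel K X ψ A) {p : Ideal (𝓞 K)} (hp : p.IsPrime) (hp0 : p ≠ ⊥)
    (m : ℕ) {a : X} (ha : a ∈ A) : ψ (⟨p, hp0⟩ ^ m) a ∈ A := by
  induction m with
  | zero => simpa using ha
  | succ m ih =>
    rw [pow_succ', map_mul]
    exact hA.2.2.1 p hp hp0 _ ih

theorem pow_congr (J P : Ideal (𝓞 L)) (hJP : J ≤ P) (x y : 𝓞 L) (h : x - y ∈ J) (q : ℕ)
    (hq : (q : 𝓞 L) ∈ P) : x ^ q - y ^ q ∈ P * J := by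
  rw [← Commute.geom_sum₂_mul (Commute.all x y)]
  refine Ideal.mul_mem_mul ?_ h
  rw [← Ideal.Quotient.eq_zero_iff_mem] at hq ⊢
  have hxy : Ideal.Quotient.mk P x = Ideal.Quotient.mk P y := Ideal.Quotient.eq.mpr (hJP h)
  simp only [map_sum, map_mul, map_pow, hxy]
  rw [Finset.sum_congr rfl (g := fun _ ↦ (Ideal.Quotient.mk P y) ^ (q - 1))]
  · rw [map_natCast] at hq
    simp [hq]
  · intro i hi
    rw [← pow_add]
    congr 1
    have := Finset.mem_range.mp hi
    omega

/-- Points fixed by a power of `ψ_𝔭` are determined by their reduction. -/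
theorem fixed_lift (hA : IsIntegralModel K X ψ A) (P : Ideal (𝓞 L)) (hP : P.IsPrime)
    (p : Ideal (𝓞 K))
    (hpP : P.under (𝓞 K) = p) (hp : p.IsPrime) (hp0 : p ≠ ⊥) (m : ℕ) (hm : m ≠ 0)
    (w w' : X →ₐ[K] L) (hw : w.comp (ψ (⟨p, hp0⟩ ^ m)) = w)
    (hw' : w'.comp (ψ (⟨p, hp0⟩ ^ m)) = w')
    (h : ∀ a ∈ A, w a - w' a ∈ coeSubmodule L P) : w = w' := by
  have hq : ((Ideal.absNorm p : ℕ) : 𝓞 L) ∈ P := by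
    have h1 : ((Ideal.absNorm p : ℕ) : 𝓞 K) ∈ P.under (𝓞 K) := hpP ▸ Ideal.absNorm_mem p
    simpa [Ideal.under, Ideal.mem_comap] using h1
  -- one step
  have step : ∀ J : Ideal (𝓞 L), J ≤ P → (∀ a ∈ A, w a - w' a ∈ coeSubmodule L J) →
      ∀ a ∈ A, w (ψ ⟨p, hp0⟩ a) - w' (ψ ⟨p, hp0⟩ a) ∈ coeSubmodule L (P * J) := by
    intro J hJ hJw a ha
    have h2 : ∀ z ∈ Submodule.span (𝓞 K) {y | ∃ r ∈ p, ∃ b ∈ A, y = r • b},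
        w z - w' z ∈ coeSubmodule L (P * J) := by
      intro z hz
      induction hz using Submodule.span_induction with
      | mem x h =>
        obtain ⟨r, hr, b, hb, rfl⟩ := h
        have e1 : w (r • b) = r • w b := map_smul (w.restrictScalars (𝓞 K)) r b
        have e2 : w' (r • b) = r • w' b := map_smul (w'.restrictScalars (𝓞 K)) r b
        rw [e1, e2, ← smul_sub]
        have hr' : r ∈ P.under (𝓞 K) := by rw [hpP]; exact hr
        exact smul_in P J hr' (hJw b hb)
      | zero => simp
      | add x y _ _ h1 h2 =>
        rw [map_add, map_add, add_sub_add_comm]; exact add_mem h1 h2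
      | smul r x _ h =>
        have e1 : w (r • x) = r • w x := map_smul (w.restrictScalars (𝓞 K)) r x
        have e2 : w' (r • x) = r • w' x := map_smul (w'.restrictScalars (𝓞 K)) r x
        rw [e1, e2, ← smul_sub, ← algebraMap_smul (𝓞 L) r]
        exact Submodule.smul_mem _ _ h
    have h3 := h2 _ (hA.2.2.2 p hp hp0 a ha)
    obtain ⟨y, hy⟩ := int_val hA w ha
    obtain ⟨y', hy'⟩ := int_val hA w' ha
    have h4 : (w a) ^ Ideal.absNorm p - (w' a) ^ Ideal.absNorm p ∈ coeSubmodule L (P * J) := by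
      refine (mem_coeSubmodule L _).mpr ⟨y ^ Ideal.absNorm p - y' ^ Ideal.absNorm p, ?_, ?_⟩
      · refine pow_congr J P hJ y y' ?_ _ hq
        apply sub_mem_of_coe
        rw [hy, hy']
        exact hJw a ha
      · rw [map_sub, map_pow, map_pow]
        rw [← hy, ← hy']
    have := add_mem h3 h4
    rw [map_sub, map_sub, map_pow, map_pow] at this
    convert this using 1
    ring
  have main : ∀ k : ℕ, ∀ a ∈ A, w a - w' a ∈ coeSubmodule L (P ^ (k + 1)) := by
    intro k
    induction k with
    | zero => simpa using h
    | succ k ih =>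
      intro a ha
      obtain ⟨m', rfl⟩ := Nat.exists_eq_succ_of_ne_zero hm
      have h5 := step (P ^ (k+1)) (Ideal.pow_le_self (Nat.succ_ne_zero k)) ih _
        (psi_mem hA hp hp0 m' ha)
      have e : ∀ v : X →ₐ[K] L, v.comp (ψ (⟨p, hp0⟩ ^ (m' + 1))) = v →
          v (ψ ⟨p, hp0⟩ (ψ (⟨p, hp0⟩ ^ m') a)) = v a := by
        intro v hv
        conv_rhs => rw [← hv]
        rw [pow_succ', map_mul]
        rfl
      rw [e w hw, e w' hw'] at h5
      rwa [pow_succ']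
  refine eq_of_eqOn hA fun a ha ↦ ?_
  obtain ⟨y, hy⟩ := int_val hA w ha
  obtain ⟨y', hy'⟩ := int_val hA w' ha
  have hmem : y - y' ∈ ⨅ i, P ^ i := by
    rw [Ideal.mem_iInf]
    intro i
    refine Ideal.pow_le_pow_right (Nat.le_succ i) (sub_mem_of_coe ?_)
    rw [hy, hy']
    exact main i a ha
  rw [Ideal.iInf_pow_eq_bot_of_isDomain P hP.ne_top, Ideal.mem_bot, sub_eq_zero] at hmem
  rw [← hy, ← hy', hmem]


theorem exists_sep [Module.Finite K X] (hA : IsIntegralModel K X ψ A) :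
    ∃ Δ : 𝓞 L, Δ ≠ 0 ∧ ∀ (t t' : X →ₐ[K] L) (P : Ideal (𝓞 L)), Δ ∉ P →
      (∀ a ∈ A, t a - t' a ∈ coeSubmodule L P) → t = t' := by
  classical
  have key : ∀ x : (X →ₐ[K] L) × (X →ₐ[K] L), ∃ δ : 𝓞 L, δ ≠ 0 ∧ (x.1 ≠ x.2 →
      ∃ a ∈ A, (δ : L) = x.1 a - x.2 a) := by
    rintro ⟨t, t'⟩
    by_cases h : t = t'
    · exact ⟨1, one_ne_zero, fun h' ↦ absurd h h'⟩
    · have : ∃ a ∈ A, t a ≠ t' a := by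
        by_contra! hc
        exact h (eq_of_eqOn hA hc)
      obtain ⟨a, ha, hne⟩ := this
      obtain ⟨y, hy⟩ := int_val hA t ha
      obtain ⟨y', hy'⟩ := int_val hA t' ha
      refine ⟨y - y', ?_, fun _ ↦ ⟨a, ha, ?_⟩⟩
      · intro h0
        rw [sub_eq_zero] at h0
        exact hne (by rw [← hy, ← hy', h0])
      · change algebraMap (𝓞 L) L (y - y') = t a - t' a
        rw [map_sub]; exact congrArg₂ (· - ·) hy hy'
  choose δ hδ0 hδ using key
  have := Fintype.ofFinite (X →ₐ[K] L)
  refine ⟨∏ x, δ x, Finset.prod_ne_zero_iff.mpr fun x _ ↦ hδ0 x, fun t t' P hP h ↦ ?_⟩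
  by_contra hne
  obtain ⟨a, ha, he⟩ := hδ (t, t') hne
  have h1 := h a ha
  have h2 : δ (t, t') ∈ P := by
    have h0 : algebraMap (𝓞 L) L (δ (t, t')) - algebraMap (𝓞 L) L 0 ∈ coeSubmodule L P := by
      have he' : algebraMap (𝓞 L) L (δ (t, t')) = t a - t' a := he
      rw [map_zero, sub_zero, he']; exact h1
    have := sub_mem_of_coe h0
    simpa using this
  exact hP (Ideal.mem_of_dvd P (Finset.dvd_prod_of_mem δ (Finset.mem_univ (t, t'))) h2)

theorem norm_eq_of_frob {E : Type*} [Field E] [NumberField E] [Algebra K E]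
    (Q : Ideal (𝓞 E)) (hQ : Q.IsPrime) (hQ0 : Q ≠ ⊥) (p : Ideal (𝓞 K)) (hp0 : p ≠ ⊥)
    (hQp : Q.under (𝓞 K) = p) (h : ∀ y : 𝓞 E, y ^ Ideal.absNorm p - y ∈ Q) :
    Ideal.absNorm Q = Ideal.absNorm p ∧ ∀ y : 𝓞 E, ∃ r : 𝓞 K, y - algebraMap (𝓞 K) (𝓞 E) r ∈ Q := by
  classical
  have : Finite (𝓞 E ⧸ Q) := Ideal.finiteQuotientOfFreeOfNeBot Q hQ0
  have : Finite (𝓞 K ⧸ p) := Ideal.finiteQuotientOfFreeOfNeBot p hp0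
  have hmax : Q.IsMaximal := hQ.isMaximal hQ0
  let : Field (𝓞 E ⧸ Q) := Ideal.Quotient.field Q
  let f : 𝓞 K ⧸ p →+* 𝓞 E ⧸ Q := Ideal.quotientMap Q (algebraMap (𝓞 K) (𝓞 E)) (by
    rw [← hQp])
  have hf : Function.Injective f := Ideal.quotientMap_injective' (by
    rw [← hQp])
  have hle : Nat.card (𝓞 K ⧸ p) ≤ Nat.card (𝓞 E ⧸ Q) := Nat.card_le_card_of_injective f hf
  set q := Ideal.absNorm p with hq
  have hq1 : 1 < q := by
    have h0 : q ≠ 0 := by simpa [hq, Ideal.absNorm_eq_zero_iff] using hp0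
    have h1 : q ≠ 1 := by
      rw [hq, Ne, Ideal.absNorm_eq_one_iff, ← hQp]
      exact (Ideal.IsPrime.under (𝓞 K) Q).ne_top
    omega
  have hge : Nat.card (𝓞 E ⧸ Q) ≤ q := by
    have := Fintype.ofFinite (𝓞 E ⧸ Q)
    let g : Polynomial (𝓞 E ⧸ Q) := Polynomial.X ^ q - Polynomial.X
    have hg : g ≠ 0 := FiniteField.X_pow_card_sub_X_ne_zero _ hq1
    have hd : g.natDegree = q := FiniteField.X_pow_card_sub_X_natDegree_eq _ hq1
    have hroots : (Finset.univ : Finset (𝓞 E ⧸ Q)).val ⊆ g.roots := by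
      intro x _
      rw [Polynomial.mem_roots hg]
      obtain ⟨y, rfl⟩ := Ideal.Quotient.mk_surjective x
      have := Ideal.Quotient.eq_zero_iff_mem.mpr (h y)
      simpa [g, Polynomial.IsRoot] using this
    rw [Nat.card_eq_fintype_card, ← Finset.card_univ, ← hd]
    exact Polynomial.card_le_degree_of_subset_roots hroots
  have hcard : Nat.card (𝓞 E ⧸ Q) = Nat.card (𝓞 K ⧸ p) := le_antisymm hge hle
  refine ⟨hcard, fun y ↦ ?_⟩
  have hsurj : Function.Surjective f :=
    ((Nat.bijective_iff_injective_and_card f).mpr ⟨hf, hcard.symm⟩).2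
  obtain ⟨r, hr⟩ := hsurj (Ideal.Quotient.mk Q y)
  obtain ⟨r, rfl⟩ := Ideal.Quotient.mk_surjective r
  refine ⟨r, ?_⟩
  rw [← Ideal.Quotient.eq, ← hr]
  rfl

theorem finite_bad {Δ : 𝓞 L} (hΔ : Δ ≠ 0) :
    {P : Ideal (𝓞 L) | P.IsPrime ∧ P ≠ ⊥ ∧ Δ ∈ P}.Finite := by
  have h := Ideal.finite_factors (R := 𝓞 L) (I := Ideal.span {Δ}) (by simpa using hΔ)
  refine (h.image (fun v ↦ v.asIdeal)).subset ?_
  rintro P ⟨hP, hP0, hm⟩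
  refine ⟨⟨P, hP, hP0⟩, ?_, rfl⟩
  simpa [Ideal.dvd_span_singleton] using hm

/-- Weak Chebotarev: a subgroup containing all Frobenius elements outside a finite set is
everything. -/
theorem frob_gen [IsGalois K L] (Z : Subgroup (L ≃ₐ[K] L)) (Δ : 𝓞 L) (hΔ : Δ ≠ 0)
    (hZ : ∀ (P : Ideal (𝓞 L)), P.IsPrime → P ≠ ⊥ → Δ ∉ P → ∃ φ ∈ Z,
      ∀ x : 𝓞 L, φ • x - x ^ Ideal.absNorm (P.under (𝓞 K)) ∈ P) : Z = ⊤ := by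
  classical
  by_contra hne
  obtain ⟨τ, hτ⟩ : ∃ τ, τ ∉ Z := by
    by_contra! hc
    exact hne (eq_top_iff.mpr fun τ _ ↦ hc τ)
  let E : IntermediateField K L := IntermediateField.fixedField Z
  have hE : E.fixingSubgroup = Z := IntermediateField.fixingSubgroup_fixedField Z
  have hθ : ∃ θ : 𝓞 E, τ • (algebraMap (𝓞 E) (𝓞 L) θ) ≠ algebraMap (𝓞 E) (𝓞 L) θ := by
    by_contra! hc
    apply hτ
    rw [← hE, IntermediateField.mem_fixingSubgroup_iff]
    intro x hx
    have hc' : ∀ θ : 𝓞 E, τ (((θ : E) : L)) = ((θ : E) : L) := fun θ ↦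
      congrArg (algebraMap (𝓞 L) L) (hc θ)
    obtain ⟨a, b, hb, hab⟩ := IsFractionRing.div_surjective (A := 𝓞 E) (⟨x, hx⟩ : E)
    have : x = ((a : E) : L) / ((b : E) : L) := congrArg (fun z : E ↦ (z : L)) hab.symm
    rw [this, map_div₀, hc', hc']
  obtain ⟨θ, hθ⟩ := hθ
  set Δ' : 𝓞 L := Δ * (τ • (algebraMap (𝓞 E) (𝓞 L) θ) - algebraMap (𝓞 E) (𝓞 L) θ) with hΔ'
  have hΔ'0 : Δ' ≠ 0 := mul_ne_zero hΔ (sub_ne_zero.mpr hθ)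
  let T : Finset (Ideal (𝓞 K)) := ((finite_bad hΔ'0).image (fun P ↦ P.under (𝓞 K))).toFinset
  have under_ne : ∀ P : Ideal (𝓞 L), P.IsPrime → P ≠ ⊥ → P.under (𝓞 K) ≠ ⊥ := fun P hP hP0 ↦
    Ideal.under_ne_bot (𝓞 K) hP0
  refine no_split K E T ?_ ?_
  · intro p hp
    obtain ⟨P, ⟨hP, hP0, -⟩, rfl⟩ := (Set.Finite.mem_toFinset _).mp hp
    exact ⟨Ideal.IsPrime.under (𝓞 K) P, under_ne P hP hP0⟩
  · intro p hp hp0 hpT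
    obtain ⟨P, -, hP, hPp⟩ := Ideal.exists_ideal_over_prime_of_isIntegral (S := 𝓞 L) p ⊥ (by
      rw [Ideal.comap_bot_of_injective _ (FaithfulSMul.algebraMap_injective _ _)]; exact bot_le)
    have hPp : P.under (𝓞 K) = p := hPp
    -- generic facts about primes over `p`
    have fact : ∀ P : Ideal (𝓞 L), P.IsPrime → P.under (𝓞 K) = p →
        Δ' ∉ P ∧ (P.under (𝓞 E)).IsPrime ∧ P.under (𝓞 E) ≠ ⊥ ∧
        (P.under (𝓞 E)).under (𝓞 K) = p ∧ ∀ y : 𝓞 E, y ^ Ideal.absNorm p - y ∈ P.under (𝓞 E) := by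
      intro P hP hPp
      have hP0 : P ≠ ⊥ := by
        rintro rfl
        apply hp0
        rw [← hPp]
        exact Ideal.comap_bot_of_injective _ (FaithfulSMul.algebraMap_injective _ _)
      have hΔP : Δ' ∉ P := fun hmem ↦ hpT ((Set.Finite.mem_toFinset _).mpr
        ⟨P, ⟨hP, hP0, hmem⟩, hPp⟩)
      have hu : (P.under (𝓞 E)).under (𝓞 K) = p := by
        rw [Ideal.under_under, hPp]
      refine ⟨hΔP, Ideal.IsPrime.under (𝓞 E) P, ?_, hu, ?_⟩
      · intro h0
        apply hp0
        rw [← hu, h0]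
        exact Ideal.comap_bot_of_injective _ (FaithfulSMul.algebraMap_injective _ _)
      · intro y
        obtain ⟨φ, hφZ, hφ⟩ := hZ P hP hP0 (fun hm ↦ hΔP (Ideal.mul_mem_right _ _ hm))
        have h1 := hφ (algebraMap (𝓞 E) (𝓞 L) y)
        have h2 : φ • (algebraMap (𝓞 E) (𝓞 L) y) = algebraMap (𝓞 E) (𝓞 L) y := by
          apply FaithfulSMul.algebraMap_injective (𝓞 L) L
          rw [← hE, IntermediateField.mem_fixingSubgroup_iff] at hφZ
          exact hφZ _ (y : E).2
        rw [h2, hPp] at h1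
        have h3 := neg_mem h1
        rw [neg_sub] at h3
        rw [Ideal.under, Ideal.mem_comap, map_sub, map_pow]
        exact h3
    let tr : 𝓞 L →+* 𝓞 L := MulSemiringAction.toRingHom (L ≃ₐ[K] L) (𝓞 L) τ
    let P' : Ideal (𝓞 L) := P.comap tr
    have hP' : P'.IsPrime := Ideal.comap_isPrime _ _
    have hPp' : P'.under (𝓞 K) = p := by
      rw [← hPp]
      ext r
      simp only [Ideal.under, Ideal.mem_comap, P']
      have : tr (algebraMap (𝓞 K) (𝓞 L) r) = algebraMap (𝓞 K) (𝓞 L) r := by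
        apply FaithfulSMul.algebraMap_injective (𝓞 L) L
        exact τ.commutes (r : K)
      rw [this]
    obtain ⟨a1, a2, a3, a4, a5⟩ := fact P hP hPp
    obtain ⟨b1, b2, b3, b4, b5⟩ := fact P' hP' hPp'
    obtain ⟨n1, s1⟩ := norm_eq_of_frob _ a2 a3 p hp0 a4 a5
    obtain ⟨n2, -⟩ := norm_eq_of_frob _ b2 b3 p hp0 b4 b5
    refine ⟨P.under (𝓞 E), P'.under (𝓞 E), ⟨a2, a3, a4, n1⟩, ⟨b2, b3, b4, n2⟩, fun heq ↦ ?_⟩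
    obtain ⟨r, hr⟩ := s1 θ
    have hr' := hr
    rw [heq] at hr'
    have c1 : algebraMap (𝓞 E) (𝓞 L) (θ - algebraMap (𝓞 K) (𝓞 E) r) ∈ P := hr
    have c2 : τ • algebraMap (𝓞 E) (𝓞 L) (θ - algebraMap (𝓞 K) (𝓞 E) r) ∈ P := hr'
    rw [map_sub] at c1 c2
    rw [smul_sub] at c2
    have c3 : τ • algebraMap (𝓞 E) (𝓞 L) (algebraMap (𝓞 K) (𝓞 E) r) =
        algebraMap (𝓞 E) (𝓞 L) (algebraMap (𝓞 K) (𝓞 E) r) := by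
      apply FaithfulSMul.algebraMap_injective (𝓞 L) L
      exact τ.commutes (r : K)
    rw [c3] at c2
    have c4 := sub_mem c2 c1
    rw [sub_sub_sub_cancel_right] at c4
    exact a1 (Ideal.mul_mem_left _ _ c4)


theorem gal_eq_psi [IsGalois K L] [Module.Finite K X] (hA : IsIntegralModel K X ψ A)
    (σ : L ≃ₐ[K] L) :
    ∃ a : NZI (𝓞 K), ∀ s : X →ₐ[K] L, σ.toAlgHom.comp s = s.comp (ψ a) := by
  obtain ⟨Δ, hΔ, hsep⟩ := exists_sep (L := L) hA
  let M : Submonoid (L ≃ₐ[K] L) :=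
    { carrier := {σ | ∃ a : NZI (𝓞 K), ∀ s : X →ₐ[K] L, σ.toAlgHom.comp s = s.comp (ψ a)}
      one_mem' := ⟨1, fun s ↦ by ext x; simp⟩
      mul_mem' := by
        rintro σ τ ⟨a, ha⟩ ⟨b, hb⟩
        refine ⟨b * a, fun s ↦ ?_⟩
        have h1 := ha (τ.toAlgHom.comp s)
        have h2 := hb s
        ext x
        have h1x := DFunLike.congr_fun h1 x
        have h2x := DFunLike.congr_fun h2 (ψ a x)
        rw [map_mul]
        exact h1x.trans h2x }
  let Z : Subgroup (L ≃ₐ[K] L) :=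
    { M with
      inv_mem' := by
        intro τ hτ
        have h1 : τ⁻¹ = τ ^ (orderOf τ - 1) := by
          rw [inv_eq_iff_mul_eq_one, ← pow_succ', Nat.sub_add_cancel (orderOf_pos τ),
            pow_orderOf_eq_one]
        rw [h1]
        exact M.pow_mem hτ _ }
  have hZ : Z = ⊤ := by
    refine frob_gen Z Δ hΔ fun P hP hP0 hΔP ↦ ?_
    obtain ⟨φ, hφ⟩ := exists_frob K L P hP hP0
    have hp0 := Ideal.under_ne_bot (𝓞 K) hP0
    refine ⟨φ, ⟨⟨P.under (𝓞 K), hp0⟩, fun s ↦ ?_⟩, hφ⟩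
    exact hsep _ _ P hΔP fun a ha ↦
      frob_congr hA P _ rfl (Ideal.IsPrime.under (𝓞 K) P) hp0 φ hφ s ha
  have : σ ∈ Z := by rw [hZ]; trivial
  exact this

theorem comp_psi_mul {M : Type*} [Field M] [Algebra K M] (u : X →ₐ[K] M) (a b : NZI (𝓞 K)) :
    u.comp (ψ (a * b)) = (u.comp (ψ a)).comp (ψ b) := by
  rw [map_mul]; rfl

theorem fixed_prime [IsGalois K L] [Module.Finite K X] (hA : IsIntegralModel K X ψ A)
    (p : Ideal (𝓞 K)) (hp : p.IsPrime) (hp0 : p ≠ ⊥) (d : NZI (𝓞 K)) (u : X →ₐ[K] L)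
    (hu : u.comp (ψ (⟨p, hp0⟩ * d)) = u) :
    ∃ φ : L ≃ₐ[K] L, u.comp (ψ ⟨p, hp0⟩) = φ.toAlgHom.comp u := by
  obtain ⟨P, -, hP, hPp⟩ := Ideal.exists_ideal_over_prime_of_isIntegral (S := 𝓞 L) p ⊥ (by
      rw [Ideal.comap_bot_of_injective _ (FaithfulSMul.algebraMap_injective _ _)]; exact bot_le)
  have hPp : P.under (𝓞 K) = p := hPp
  have hP0 : P ≠ ⊥ := by
    rintro rfl
    apply hp0
    rw [← hPp]
    exact Ideal.comap_bot_of_injective _ (FaithfulSMul.algebraMap_injective _ _)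
  obtain ⟨φ, hφ⟩ := exists_frob K L P hP hP0
  rw [hPp] at hφ
  set q : NZI (𝓞 K) := ⟨p, hp0⟩ with hq
  have hpow : ∀ i : ℕ, u.comp (ψ ((q * d) ^ i)) = u := by
    intro i
    induction i with
    | zero => ext x; simp
    | succ i ih => rw [pow_succ, comp_psi_mul, ih, hu]
  obtain ⟨i, j, hij, he⟩ : ∃ i j : ℕ, i < j ∧ u.comp (ψ (q ^ i)) = u.comp (ψ (q ^ j)) := by
    obtain ⟨i, j, hne, he⟩ := Finite.exists_ne_map_eq_of_infinite
      (fun i : ℕ ↦ u.comp (ψ (q ^ i)))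
    rcases lt_or_gt_of_ne hne with h | h
    · exact ⟨i, j, h, he⟩
    · exact ⟨j, i, h, he.symm⟩
  have hm : u.comp (ψ (q ^ (j - i))) = u := by
    have h1 : (u.comp (ψ (q ^ i))).comp (ψ (d ^ i)) = (u.comp (ψ (q ^ j))).comp (ψ (d ^ i)) := by
      rw [he]
    rw [← comp_psi_mul, ← comp_psi_mul, ← mul_pow, hpow] at h1
    have h2 : q ^ j * d ^ i = (q * d) ^ i * q ^ (j - i) := by
      conv_lhs => rw [← Nat.add_sub_cancel' hij.le, pow_add]
      rw [mul_pow]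
      exact mul_right_comm _ _ _
    rw [h2, comp_psi_mul, hpow] at h1
    exact h1.symm
  refine ⟨φ, (fixed_lift hA P hP p hPp hp hp0 (j - i) (by omega) _ _ ?_ ?_ fun a ha ↦
    frob_congr hA P p hPp hp hp0 φ hφ u ha).symm⟩
  · rw [AlgHom.comp_assoc, hm]
  · rw [← comp_psi_mul, mul_comm, comp_psi_mul, hm]

theorem nzi_induction {C : NZI (𝓞 K) → Prop} (h1 : C 1)
    (hmul : ∀ (p : Ideal (𝓞 K)) (_ : p.IsPrime) (hp0 : p ≠ ⊥) (a : NZI (𝓞 K)), C a →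
      C (⟨p, hp0⟩ * a)) (a : NZI (𝓞 K)) : C a := by
  obtain ⟨I, hI⟩ := a
  induction I using UniqueFactorizationMonoid.induction_on_prime with
  | h₁ => exact absurd rfl hI
  | h₂ x hx =>
    obtain rfl : x = 1 := by simpa using hx
    exact h1
  | h₃ a p ha hp ih =>
    exact hmul p (Ideal.isPrime_of_prime hp) hp.ne_zero ⟨a, ha⟩ (ih ha)

theorem fixed_all [IsGalois K L] [Module.Finite K X] (hA : IsIntegralModel K X ψ A)
    (a : NZI (𝓞 K)) : ∀ (d : NZI (𝓞 K)) (u : X →ₐ[K] L)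
    (_ : u.comp (ψ (a * d)) = u),
    ∃ φ : L ≃ₐ[K] L, u.comp (ψ a) = φ.toAlgHom.comp u := by
  induction a using nzi_induction with
  | h1 => exact fun d u _ ↦ ⟨AlgEquiv.refl, by ext x; simp⟩
  | hmul p hp hp0 a ih =>
    intro d u hu
    obtain ⟨φ, hφ⟩ := fixed_prime hA p hp hp0 (a * d) u (by rw [← mul_assoc]; exact hu)
    obtain ⟨φ', hφ'⟩ := ih (⟨p, hp0⟩ * d) u (by rw [mul_left_comm, ← mul_assoc]; exact hu)
    refine ⟨φ * φ', ?_⟩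
    rw [comp_psi_mul, hφ, AlgHom.comp_assoc, hφ']
    rfl

end alg

section descend

variable {K X : Type*} [Field K] [NumberField K] [CommRing X] [Algebra K X] [Module.Finite K X]

theorem exists_big (K X : Type*) [Field K] [NumberField K] [CommRing X] [Algebra K X]
    [Module.Finite K X] : ∃ L : IntermediateField K (Kbar K), FiniteDimensional K L ∧
      IsGalois K L ∧ ∀ (s : X →ₐ[K] Kbar K) (x : X), s x ∈ L := by
  classical
  obtain ⟨B, hB⟩ := Module.Finite.fg_top (R := K) (M := X)
  let Bset : Set (Kbar K) := Set.range (fun y : (X →ₐ[K] Kbar K) × B ↦ y.1 y.2.1)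
  have : Finite Bset := Set.finite_range _
  let L := FiniteGaloisIntermediateField.adjoin K Bset
  refine ⟨L.toIntermediateField, L.finiteDimensional, L.isGalois, fun s x ↦ ?_⟩
  have hx : x ∈ Submodule.span K (B : Set X) := by rw [hB]; trivial
  induction hx using Submodule.span_induction with
  | mem x h => exact FiniteGaloisIntermediateField.subset_adjoin K Bset ⟨(s, ⟨x, h⟩), rfl⟩
  | zero => rw [map_zero]; exact zero_mem _
  | add x y _ _ h1 h2 => rw [map_add]; exact add_mem h1 h2
  | smul r x _ h => rw [map_smul]; exact L.toIntermediateField.smul_mem h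

variable {ψ : NZI (𝓞 K) →* (X →ₐ[K] X)} {A : Subalgebra (𝓞 K) X}

theorem bar_facts (hA : IsIntegralModel K X ψ A) :
    (∀ σ : Kbar K ≃ₐ[K] Kbar K, ∃ a : NZI (𝓞 K), ∀ s : X →ₐ[K] Kbar K,
      σ.toAlgHom.comp s = s.comp (ψ a)) ∧
    (∀ (a d : NZI (𝓞 K)) (u : X →ₐ[K] Kbar K), u.comp (ψ (a * d)) = u →
      ∃ σ : Kbar K ≃ₐ[K] Kbar K, u.comp (ψ a) = σ.toAlgHom.comp u) := by
  obtain ⟨L, hfin, hgal, hL⟩ := exists_big K X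
  have : NumberField L := NumberField.of_module_finite K L
  let r : (X →ₐ[K] Kbar K) → (X →ₐ[K] L) := fun s ↦ s.codRestrict L.toSubalgebra (hL s)
  have hr : ∀ s x, ((r s x : L) : Kbar K) = s x := fun s x ↦ rfl
  constructor
  · intro σ
    obtain ⟨a, ha⟩ := gal_eq_psi hA (σ.restrictNormal L)
    refine ⟨a, fun s ↦ ?_⟩
    ext x
    have h1 := congrArg (algebraMap L (Kbar K)) (DFunLike.congr_fun (ha (r s)) x)
    have h2 := σ.restrictNormal_commutes L (r s x)
    exact h2.symm.trans h1
  · intro a d u hu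
    obtain ⟨φ, hφ⟩ := fixed_all hA a d (r u) (by
      ext x
      exact DFunLike.congr_fun hu x)
    refine ⟨φ.liftNormal (Kbar K), ?_⟩
    ext x
    have h1 := congrArg (algebraMap L (Kbar K)) (DFunLike.congr_fun hφ x)
    have h2 := φ.liftNormal_commutes (Kbar K) (r u x)
    exact h1.trans h2.symm

theorem sep_points [IsReduced X] {f g : X →ₐ[K] X}
    (h : ∀ s : X →ₐ[K] Kbar K, s.comp f = s.comp g) : f = g := by
  ext x
  rw [← sub_eq_zero]
  by_contra hne
  have : ¬ IsNilpotent (f x - g x) := fun hn ↦ hne hn.eq_zero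
  rw [nilpotent_iff_mem_prime] at this
  push Not at this
  obtain ⟨P, hP, hmem⟩ := this
  have : IsArtinianRing X := IsArtinianRing.of_finite K X
  have hmax : P.IsMaximal := IsArtinianRing.isMaximal_of_isPrime P
  let : Field (X ⧸ P) := Ideal.Quotient.field P
  let l : (X ⧸ P) →ₐ[K] Kbar K := IsAlgClosed.lift
  have h1 := DFunLike.congr_fun (h (l.comp (Ideal.Quotient.mkₐ K P))) x
  have h2 : Ideal.Quotient.mk P (f x) = Ideal.Quotient.mk P (g x) := l.toRingHom.injective h1
  exact hmem (Ideal.Quotient.eq.mp h2)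

theorem comm_all {f : X →ₐ[K] X}
    (hf : ∀ (p : Ideal (𝓞 K)) (_ : p.IsPrime) (hp : p ≠ ⊥),
      f.comp (ψ ⟨p, hp⟩) = (ψ ⟨p, hp⟩).comp f) (a : NZI (𝓞 K)) :
    f.comp (ψ a) = (ψ a).comp f := by
  induction a using nzi_induction with
  | h1 => ext x; simp
  | hmul p hp hp0 a ih =>
    rw [map_mul]
    change f * (ψ ⟨p, hp0⟩ * ψ a) = (ψ ⟨p, hp0⟩ * ψ a) * f
    have e1 : f * ψ ⟨p, hp0⟩ = ψ ⟨p, hp0⟩ * f := hf p hp hp0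
    have e2 : f * ψ a = ψ a * f := ih
    rw [← mul_assoc, e1, mul_assoc, e2, mul_assoc]

theorem psi_comm (a b : NZI (𝓞 K)) : (ψ a).comp (ψ b) = (ψ b).comp (ψ a) := by
  change ψ a * ψ b = ψ b * ψ a
  rw [← map_mul, mul_comm, map_mul]

end descend

/-- Let `X` be a galois object with root `s₀`, and let `f, f'` be
`K`-algebra endomorphisms of `X` commuting with every `ψ_𝔭` (elements of `End(X)`).
Then `f` and `f'` are `𝒥`-equivalent in `End(X)` (i.e. `f = f' ∘ g` and `f' = f ∘ g'`
for some `g, g' ∈ End(X)`) if and only if `s₀ ∘ f` and `s₀ ∘ f'` lie in the same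
`Gal(K̄/K)`-orbit. -/
theorem jequiv_iff_same_galois_orbit [Module.Finite K X] [IsReduced X]
    (ψ : NZI (𝓞 K) →* (X →ₐ[K] X)) (A : Subalgebra (𝓞 K) X)
    (hA : IsIntegralModel K X ψ A) (s0 : X →ₐ[K] Kbar K)
    (hroot : ∀ s : X →ₐ[K] Kbar K, ∃ (σ : Kbar K ≃ₐ[K] Kbar K) (a : NZI (𝓞 K)),
      s = (σ.toAlgHom.comp s0).comp (ψ a))
    (f f' : X →ₐ[K] X)
    (hf : ∀ (p : Ideal (𝓞 K)) (_ : p.IsPrime) (hp : p ≠ ⊥),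
      f.comp (ψ ⟨p, hp⟩) = (ψ ⟨p, hp⟩).comp f)
    (hf' : ∀ (p : Ideal (𝓞 K)) (_ : p.IsPrime) (hp : p ≠ ⊥),
      f'.comp (ψ ⟨p, hp⟩) = (ψ ⟨p, hp⟩).comp f') :
    ((∃ g g' : X →ₐ[K] X,
        (∀ (p : Ideal (𝓞 K)) (_ : p.IsPrime) (hp : p ≠ ⊥),
          g.comp (ψ ⟨p, hp⟩) = (ψ ⟨p, hp⟩).comp g) ∧
        (∀ (p : Ideal (𝓞 K)) (_ : p.IsPrime) (hp : p ≠ ⊥),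
          g'.comp (ψ ⟨p, hp⟩) = (ψ ⟨p, hp⟩).comp g') ∧
        f = f'.comp g ∧ f' = f.comp g') ↔
      ∃ σ : Kbar K ≃ₐ[K] Kbar K,
        s0.comp f = σ.toAlgHom.comp (s0.comp f')) := by
  obtain ⟨hG1, hG2⟩ := bar_facts hA
  -- every point is `s0 ∘ ψ_c`
  have hroot' : ∀ s : X →ₐ[K] Kbar K, ∃ c : NZI (𝓞 K), s = s0.comp (ψ c) := by
    intro s
    obtain ⟨σ, a, rfl⟩ := hroot s
    obtain ⟨b, hb⟩ := hG1 σ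
    exact ⟨b * a, by rw [hb, comp_psi_mul]⟩
  -- an equivariant map is determined by its value at the root
  have hdet : ∀ f g : X →ₐ[K] X,
      (∀ (p : Ideal (𝓞 K)) (_ : p.IsPrime) (hp : p ≠ ⊥),
        f.comp (ψ ⟨p, hp⟩) = (ψ ⟨p, hp⟩).comp f) →
      (∀ (p : Ideal (𝓞 K)) (_ : p.IsPrime) (hp : p ≠ ⊥),
        g.comp (ψ ⟨p, hp⟩) = (ψ ⟨p, hp⟩).comp g) →
      s0.comp f = s0.comp g → f = g := by
    intro f g hf hg h
    refine sep_points fun s ↦ ?_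
    obtain ⟨c, rfl⟩ := hroot' s
    rw [AlgHom.comp_assoc, AlgHom.comp_assoc, ← comm_all hf, ← comm_all hg,
      ← AlgHom.comp_assoc, ← AlgHom.comp_assoc, h]
  have hcomp : ∀ (f : X →ₐ[K] X) (a : NZI (𝓞 K)),
      (∀ (p : Ideal (𝓞 K)) (_ : p.IsPrime) (hp : p ≠ ⊥),
        f.comp (ψ ⟨p, hp⟩) = (ψ ⟨p, hp⟩).comp f) →
      (∀ (p : Ideal (𝓞 K)) (_ : p.IsPrime) (hp : p ≠ ⊥),
        (f.comp (ψ a)).comp (ψ ⟨p, hp⟩) = (ψ ⟨p, hp⟩).comp (f.comp (ψ a))) := by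
    intro f a hf p hp hp0
    rw [AlgHom.comp_assoc, psi_comm, ← AlgHom.comp_assoc, hf p hp hp0, AlgHom.comp_assoc]
  have hpsi : ∀ g : X →ₐ[K] X,
      (∀ (p : Ideal (𝓞 K)) (_ : p.IsPrime) (hp : p ≠ ⊥),
        g.comp (ψ ⟨p, hp⟩) = (ψ ⟨p, hp⟩).comp g) → ∃ c, g = ψ c := by
    intro g hg
    obtain ⟨c, hc⟩ := hroot' (s0.comp g)
    exact ⟨c, hdet _ _ hg (fun p _ hp0 ↦ psi_comm c ⟨p, hp0⟩) hc⟩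
  constructor
  · rintro ⟨g, g', hg, hg', h1, h2⟩
    obtain ⟨c, rfl⟩ := hpsi g hg
    obtain ⟨d, rfl⟩ := hpsi g' hg'
    obtain ⟨σ, hσ⟩ := hG2 c d (s0.comp f') (by
      rw [comp_psi_mul, AlgHom.comp_assoc s0, ← h1, AlgHom.comp_assoc, ← h2])
    refine ⟨σ, ?_⟩
    rw [← hσ, AlgHom.comp_assoc, ← h1]
  · rintro ⟨σ, hσ⟩
    have hσ' : s0.comp f' = σ.symm.toAlgHom.comp (s0.comp f) := by
      rw [hσ]
      ext x
      simp
    obtain ⟨c, hc⟩ := hG1 σ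
    obtain ⟨d, hd⟩ := hG1 σ.symm
    refine ⟨ψ c, ψ d, fun p _ hp0 ↦ psi_comm c ⟨p, hp0⟩, fun p _ hp0 ↦ psi_comm d ⟨p, hp0⟩,
      hdet _ _ hf (hcomp f' c hf') ?_, hdet _ _ hf' (hcomp f d hf) ?_⟩
    · rw [hσ, hc, AlgHom.comp_assoc]
    · rw [hσ', hd, AlgHom.comp_assoc]
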